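/- arXiv:1211.4725 — 2 statements merged into one kernel-verified Lean document; each statement's English description precedes it below -/
import Mathlib

section
/- Let n ≥ 1, let V be a finite-dimensional real vector space, and let a_0, ā_1, …, ā_n ∈ End(V) with a_0 semisimple. Define Ā_S ∈ End(V^{n+1}) by (Ā_S x)_j = a_0 x_j + (ā_1 + ⋯ + ā_n) x_0. Then Ā_S is semisimple if and only if a_0 + ā_1 + ⋯ + ā_n is semisimple. -/
/-- The operator `a N_i ∈ End(V^{n+1})`, `(a N_i x)_j = a (x_{max(j-i,0)})`. -/
def ffN (n : ℕ) (V : Type*) [AddCommGroup V] [Module ℝ V] (i : ℕ) (a : Module.End ℝ V) :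
    Module.End ℝ (Fin (n + 1) → V) :=
  LinearMap.pi fun j : Fin (n + 1) =>
    a ∘ₗ LinearMap.proj (⟨j.val - i, Nat.lt_of_le_of_lt (Nat.sub_le _ _) j.isLt⟩ : Fin (n + 1))

/-- The candidate semisimple part `(Ā_S x)_j = a₀ x_j + (ā_1 + ⋯ + ā_n) x_0`. -/
def ffAbarS (n : ℕ) (V : Type*) [AddCommGroup V] [Module ℝ V]
    (a0 : Module.End ℝ V) (abar : ℕ → Module.End ℝ V) : Module.End ℝ (Fin (n + 1) → V) :=
  ffN n V 0 a0 + ffN n V n (∑ i ∈ Finset.Icc 1 n, abar i)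

open Polynomial UniqueFactorizationMonoid in
/-- Two squarefree polynomials over a field have a squarefree common multiple. -/
theorem exists_squarefree_common_multiple {K : Type*} [Field K] {p q : K[X]}
    (hp : Squarefree p) (hq : Squarefree q) : ∃ r : K[X], Squarefree r ∧ p ∣ r ∧ q ∣ r := by
  classical
  have hpq : p * q ≠ 0 := mul_ne_zero hp.ne_zero hq.ne_zero
  exact ⟨radical (p * q), squarefree_radical,
    (dvd_radical_iff hp.isRadical hpq).2 (dvd_mul_right p q),
    (dvd_radical_iff hq.isRadical hpq).2 (dvd_mul_left q p)⟩

theorem ffAbarS_apply (n : ℕ) (V : Type*) [AddCommGroup V] [Module ℝ V]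
    (a0 : Module.End ℝ V) (abar : ℕ → Module.End ℝ V) (x : Fin (n + 1) → V) (j : Fin (n + 1)) :
    ffAbarS n V a0 abar x j = a0 (x j) + (∑ i ∈ Finset.Icc 1 n, abar i) (x 0) := by
  have h : (⟨j.val - n, Nat.lt_of_le_of_lt (Nat.sub_le _ _) j.isLt⟩ : Fin (n + 1)) = 0 :=
    Fin.ext (Nat.sub_eq_zero_of_le (Nat.le_of_lt_succ j.isLt))
  simp only [ffAbarS, ffN, LinearMap.add_apply, Pi.add_apply, LinearMap.pi_apply,
    LinearMap.comp_apply, LinearMap.proj_apply, h]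
  rfl

open Polynomial in
/-- In the coordinates `x_0` and `x_j - x_0` the operator `Ā_S` is block diagonal. -/
theorem aeval_ffAbarS_apply (n : ℕ) (V : Type*) [AddCommGroup V] [Module ℝ V]
    (a0 : Module.End ℝ V) (abar : ℕ → Module.End ℝ V) (p : ℝ[X])
    (x : Fin (n + 1) → V) (j : Fin (n + 1)) :
    aeval (ffAbarS n V a0 abar) p x j =
      aeval a0 p (x j - x 0) + aeval (a0 + ∑ i ∈ Finset.Icc 1 n, abar i) p (x 0) := by
  induction p using Polynomial.induction_on generalizing x with
  | C r => simp [Module.algebraMap_end_apply, smul_sub]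
  | add p q hp hq =>
    simp only [map_add, LinearMap.add_apply, Pi.add_apply, hp, hq]
    abel
  | monomial k r ih =>
    simp only [pow_succ, ← mul_assoc]
    generalize C r * X ^ k = q at ih ⊢
    simp only [map_mul, aeval_X, Module.End.mul_apply, ih, ffAbarS_apply,
      add_sub_add_right_eq_sub, map_sub, LinearMap.add_apply]

/-- With `a₀` semisimple, `Ā_S` is semisimple if and only if
`a₀ + ā_1 + ⋯ + ā_n` is semisimple. -/
theorem ffAbarS_isSemisimple_iff (n : ℕ) (hn : 1 ≤ n) (V : Type*)
    [AddCommGroup V] [Module ℝ V] [FiniteDimensional ℝ V]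
    (a0 : Module.End ℝ V) (abar : ℕ → Module.End ℝ V) (ha0 : a0.IsSemisimple) :
    (ffAbarS n V a0 abar).IsSemisimple ↔
      (a0 + ∑ i ∈ Finset.Icc 1 n, abar i).IsSemisimple := by
  constructor
  · intro h
    refine Module.End.isSemisimple_of_squarefree_aeval_eq_zero h.minpoly_squarefree ?_
    ext v
    simpa [minpoly.aeval] using (aeval_ffAbarS_apply n V a0 abar
      (minpoly ℝ (ffAbarS n V a0 abar)) (fun _ => v) 0).symm
  · intro h
    obtain ⟨r, hr, h0, h1⟩ :=
      exists_squarefree_common_multiple ha0.minpoly_squarefree h.minpoly_squarefree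
    refine Module.End.isSemisimple_of_squarefree_aeval_eq_zero hr ?_
    refine LinearMap.ext fun x => funext fun j => ?_
    rw [aeval_ffAbarS_apply, (minpoly.dvd_iff).1 h0, (minpoly.dvd_iff).1 h1]
    simp
end

section
/- Let n ≥ 1, let V = ℝ², and let a_0 ∈ End(ℝ²) have characteristic polynomial t² + ω₀² with ω₀ ≠ 0. Let ā_1, …, ā_n ∈ End(ℝ²) satisfy a_0 ā_i = ā_i a_0 for 1 ≤ i ≤ n−1, let Ā ∈ End((ℝ²)^{n+1}) be the feed-forward operator (Āx)_j = a_0 x_j + Σ_{i=1}^n ā_i x_{max(j−i,0)}, and let Ā_S, Ā_N ∈ End((ℝ²)^{n+1}) be given by (Ā_S x)_j = a_0 x_j + (ā_1 + ⋯ + ā_n) x_0 and Ā_N = Ā − Ā_S. Then the subspace V₀^{n+1} := {x ∈ (ℝ²)^{n+1} : x_0 = 0} is invariant under both Ā_S and Ā_N, the restriction of Ā_S to V₀^{n+1} is semisimple, the restriction of Ā_N is nilpotent, and the two restrictions commute; hence Ā|_{V₀^{n+1}} = Ā_S|_{V₀^{n+1}} + Ā_N|_{V₀^{n+1}} is the Jordan–Chevalley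 (SN-) decomposition of the restriction of Ā to V₀^{n+1}. -/
/-- The linear feed-forward operator `(Ā x)_j = a₀ x_j + Σ_{i=1}^n ā_i x_{max(j-i,0)}`. -/
def ffAbar (n : ℕ) (V : Type*) [AddCommGroup V] [Module ℝ V]
    (a0 : Module.End ℝ V) (abar : ℕ → Module.End ℝ V) : Module.End ℝ (Fin (n + 1) → V) :=
  ffN n V 0 a0 + ∑ i ∈ Finset.Icc 1 n, ffN n V i (abar i)

/-- The subspace `V₀^{n+1} = {x ∈ V^{n+1} : x_0 = 0}`. -/
def V0sub (n : ℕ) (V : Type*) [AddCommGroup V] [Module ℝ V] :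
    Submodule ℝ (Fin (n + 1) → V) where
  carrier := {x | x 0 = 0}
  add_mem' := by
    intro a b ha hb
    show a 0 + b 0 = 0
    rw [ha, hb, add_zero]
  zero_mem' := rfl
  smul_mem' := by
    intro r x hx
    show r • x 0 = 0
    rw [hx, smul_zero]

theorem mem_V0sub {n : ℕ} {V : Type*} [AddCommGroup V] [Module ℝ V] {x : Fin (n + 1) → V} :
    x ∈ V0sub n V ↔ x 0 = 0 := Iff.rfl

theorem ffN_apply (n : ℕ) {V : Type*} [AddCommGroup V] [Module ℝ V] (i : ℕ)
    (a : Module.End ℝ V) (x : Fin (n + 1) → V) (j : Fin (n + 1)) :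
    ffN n V i a x j
      = a (x ⟨j.val - i, Nat.lt_of_le_of_lt (Nat.sub_le _ _) j.isLt⟩) := rfl

theorem apply_eq_zero_of_mem_V0sub {n : ℕ} {V : Type*} [AddCommGroup V] [Module ℝ V]
    {x : Fin (n + 1) → V} (hx : x ∈ V0sub n V) {m : ℕ} (hm : m < n + 1) (h0 : m = 0) :
    x ⟨m, hm⟩ = 0 := by
  subst h0
  exact hx

theorem ffAbarS_apply_of_mem_V0sub {n : ℕ} {V : Type*} [AddCommGroup V] [Module ℝ V]
    (a0 : Module.End ℝ V) (abar : ℕ → Module.End ℝ V) {x : Fin (n + 1) → V}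
    (hx : x ∈ V0sub n V) (j : Fin (n + 1)) :
    ffAbarS n V a0 abar x j = a0 (x j) := by
  rw [ffAbarS, LinearMap.add_apply, Pi.add_apply, ffN_apply, ffN_apply,
    apply_eq_zero_of_mem_V0sub hx (m := j.val - n) _ (by omega), map_zero, add_zero]
  rfl

theorem ffAbar_sub_ffAbarS_apply_of_mem_V0sub {n : ℕ} {V : Type*} [AddCommGroup V]
    [Module ℝ V] (a0 : Module.End ℝ V) (abar : ℕ → Module.End ℝ V) {x : Fin (n + 1) → V}
    (hx : x ∈ V0sub n V) (j : Fin (n + 1)) :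
    (ffAbar n V a0 abar - ffAbarS n V a0 abar) x j
      = ∑ i ∈ Finset.Icc 1 n,
          abar i (x ⟨j.val - i, Nat.lt_of_le_of_lt (Nat.sub_le _ _) j.isLt⟩) := by
  rw [LinearMap.sub_apply, Pi.sub_apply, ffAbarS_apply_of_mem_V0sub a0 abar hx, ffAbar,
    LinearMap.add_apply, Pi.add_apply, LinearMap.sum_apply, Finset.sum_apply]
  exact add_sub_cancel_left (a0 (x j)) _

theorem ffAbarS_mem_V0sub {n : ℕ} {V : Type*} [AddCommGroup V] [Module ℝ V]
    (a0 : Module.End ℝ V) (abar : ℕ → Module.End ℝ V) (x : Fin (n + 1) → V)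
    (hx : x ∈ V0sub n V) : ffAbarS n V a0 abar x ∈ V0sub n V := by
  rw [mem_V0sub, ffAbarS_apply_of_mem_V0sub a0 abar hx, mem_V0sub.1 hx, map_zero]

theorem ffAbar_sub_ffAbarS_mem_V0sub {n : ℕ} {V : Type*} [AddCommGroup V] [Module ℝ V]
    (a0 : Module.End ℝ V) (abar : ℕ → Module.End ℝ V) (x : Fin (n + 1) → V)
    (hx : x ∈ V0sub n V) : (ffAbar n V a0 abar - ffAbarS n V a0 abar) x ∈ V0sub n V := by
  rw [mem_V0sub, ffAbar_sub_ffAbarS_apply_of_mem_V0sub a0 abar hx]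
  refine Finset.sum_eq_zero fun i _ => ?_
  rw [apply_eq_zero_of_mem_V0sub hx _ (by simp), map_zero]

theorem ffAbar_mem_V0sub {n : ℕ} {V : Type*} [AddCommGroup V] [Module ℝ V]
    (a0 : Module.End ℝ V) (abar : ℕ → Module.End ℝ V) (x : Fin (n + 1) → V)
    (hx : x ∈ V0sub n V) : ffAbar n V a0 abar x ∈ V0sub n V := by
  simpa using add_mem (ffAbar_sub_ffAbarS_mem_V0sub a0 abar x hx)
    (ffAbarS_mem_V0sub a0 abar x hx)

theorem isSemisimple_ffAbarS_restrict {n : ℕ} {V : Type*} [AddCommGroup V] [Module ℝ V]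
    (a0 : Module.End ℝ V) (abar : ℕ → Module.End ℝ V) {ω : ℝ} (hω : ω ≠ 0)
    (ha0 : ∀ v, a0 (a0 v) = -(ω ^ 2 • v)) :
    Module.End.IsSemisimple
      ((ffAbarS n V a0 abar).restrict (ffAbarS_mem_V0sub a0 abar)) := by
  have hsep : (Polynomial.X ^ 2 - Polynomial.C (-(ω ^ 2)) : Polynomial ℝ).Separable :=
    Polynomial.separable_X_pow_sub_C _ (by norm_num) (neg_ne_zero.2 (pow_ne_zero 2 hω))
  refine Module.End.isSemisimple_of_squarefree_aeval_eq_zero hsep.squarefree ?_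
  refine LinearMap.ext fun x => Subtype.ext (funext fun j => ?_)
  have h : ffAbarS n V a0 abar (ffAbarS n V a0 abar x) j = -(ω ^ 2 • (x : Fin (n + 1) → V) j) := by
    rw [ffAbarS_apply_of_mem_V0sub a0 abar (ffAbarS_mem_V0sub a0 abar _ x.2),
      ffAbarS_apply_of_mem_V0sub a0 abar x.2, ha0]
  simp [-map_pow, Polynomial.aeval_X_pow, pow_two (LinearMap.restrict _ _),
    Module.algebraMap_end_apply, h]

theorem isNilpotent_ffAbar_sub_ffAbarS_restrict {n : ℕ} {V : Type*} [AddCommGroup V]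
    [Module ℝ V] (a0 : Module.End ℝ V) (abar : ℕ → Module.End ℝ V) :
    IsNilpotent ((ffAbar n V a0 abar - ffAbarS n V a0 abar).restrict
      (ffAbar_sub_ffAbarS_mem_V0sub a0 abar)) := by
  have key : ∀ (k : ℕ) (x : V0sub n V) (j : Fin (n + 1)), j.val ≤ k →
      ((((ffAbar n V a0 abar - ffAbarS n V a0 abar).restrict
        (ffAbar_sub_ffAbarS_mem_V0sub a0 abar)) ^ k) x : Fin (n + 1) → V) j = 0 := by
    intro k
    induction k with
    | zero =>
      intro x j hj
      exact apply_eq_zero_of_mem_V0sub x.2 j.isLt (by omega)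
    | succ k ih =>
      intro x j hj
      rw [pow_succ', Module.End.mul_apply, LinearMap.coe_restrict_apply,
        ffAbar_sub_ffAbarS_apply_of_mem_V0sub a0 abar (Subtype.property _)]
      refine Finset.sum_eq_zero fun i hi => ?_
      rw [ih, map_zero]
      have := (Finset.mem_Icc.1 hi).1
      simp only
      omega
  exact ⟨n, LinearMap.ext fun x => Subtype.ext (funext fun j => key n x j (by omega))⟩

theorem commute_ffAbarS_restrict {n : ℕ} {V : Type*} [AddCommGroup V] [Module ℝ V]
    (a0 : Module.End ℝ V) (abar : ℕ → Module.End ℝ V)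
    (hcomm : ∀ i : ℕ, 1 ≤ i → i ≤ n - 1 → a0 * abar i = abar i * a0) :
    Commute ((ffAbarS n V a0 abar).restrict (ffAbarS_mem_V0sub a0 abar))
      ((ffAbar n V a0 abar - ffAbarS n V a0 abar).restrict
        (ffAbar_sub_ffAbarS_mem_V0sub a0 abar)) := by
  refine LinearMap.ext fun x => Subtype.ext (funext fun j => ?_)
  rw [Module.End.mul_apply, Module.End.mul_apply, LinearMap.coe_restrict_apply,
    LinearMap.coe_restrict_apply, LinearMap.coe_restrict_apply, LinearMap.coe_restrict_apply,
    ffAbarS_apply_of_mem_V0sub a0 abar (ffAbar_sub_ffAbarS_mem_V0sub a0 abar _ x.2),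
    ffAbar_sub_ffAbarS_apply_of_mem_V0sub a0 abar x.2,
    ffAbar_sub_ffAbarS_apply_of_mem_V0sub a0 abar (ffAbarS_mem_V0sub a0 abar _ x.2), map_sum]
  refine Finset.sum_congr rfl fun i hi => ?_
  rw [ffAbarS_apply_of_mem_V0sub a0 abar x.2]
  obtain ⟨h1, h2⟩ := Finset.mem_Icc.1 hi
  by_cases h : i ≤ n - 1
  · exact LinearMap.congr_fun (hcomm i h1 h) _
  · rw [apply_eq_zero_of_mem_V0sub x.2 _ (by omega)]
    simp only [map_zero]

/-- For `V = ℝ²`, `a₀` with characteristic polynomial `t² + ω₀²`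
(`ω₀ ≠ 0`), and `ā_i` commuting with `a₀` for `1 ≤ i ≤ n-1`, the subspace
`V₀^{n+1} = {x : x_0 = 0}` is invariant under `Ā_S` and `Ā_N = Ā - Ā_S`; the
restriction of `Ā_S` is semisimple, the restriction of `Ā_N` is nilpotent, they
commute, and their sum is the restriction of `Ā`: this is the Jordan–Chevalley
decomposition of `Ā` restricted to `V₀^{n+1}`. -/
theorem ffAbar_SN_on_V0 (n : ℕ) (hn : 1 ≤ n)
    (a0 : Module.End ℝ (Fin 2 → ℝ)) (ω₀ : ℝ) (hω₀ : ω₀ ≠ 0)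
    (hchar : a0.charpoly = Polynomial.X ^ 2 + Polynomial.C (ω₀ ^ 2))
    (abar : ℕ → Module.End ℝ (Fin 2 → ℝ))
    (hcomm : ∀ i : ℕ, 1 ≤ i → i ≤ n - 1 → a0 * abar i = abar i * a0) :
    ∃ (hS : ∀ x ∈ V0sub n (Fin 2 → ℝ),
        ffAbarS n (Fin 2 → ℝ) a0 abar x ∈ V0sub n (Fin 2 → ℝ))
      (hN : ∀ x ∈ V0sub n (Fin 2 → ℝ),
        (ffAbar n (Fin 2 → ℝ) a0 abar - ffAbarS n (Fin 2 → ℝ) a0 abar) x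
          ∈ V0sub n (Fin 2 → ℝ))
      (hA : ∀ x ∈ V0sub n (Fin 2 → ℝ),
        ffAbar n (Fin 2 → ℝ) a0 abar x ∈ V0sub n (Fin 2 → ℝ)),
      Module.End.IsSemisimple ((ffAbarS n (Fin 2 → ℝ) a0 abar).restrict hS) ∧
      IsNilpotent ((ffAbar n (Fin 2 → ℝ) a0 abar
        - ffAbarS n (Fin 2 → ℝ) a0 abar).restrict hN) ∧
      Commute ((ffAbarS n (Fin 2 → ℝ) a0 abar).restrict hS)
        ((ffAbar n (Fin 2 → ℝ) a0 abar - ffAbarS n (Fin 2 → ℝ) a0 abar).restrict hN) ∧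
      (ffAbar n (Fin 2 → ℝ) a0 abar).restrict hA
        = (ffAbarS n (Fin 2 → ℝ) a0 abar).restrict hS
          + (ffAbar n (Fin 2 → ℝ) a0 abar - ffAbarS n (Fin 2 → ℝ) a0 abar).restrict hN := by
  have ha0 : ∀ v, a0 (a0 v) = -(ω₀ ^ 2 • v) := fun v => by
    have h := LinearMap.congr_fun a0.aeval_self_charpoly v
    rw [hchar] at h
    refine eq_neg_of_add_eq_zero_left ?_
    simpa [-map_pow, Polynomial.aeval_X_pow, pow_two a0, Module.algebraMap_end_apply] using h
  exact ⟨ffAbarS_mem_V0sub a0 abar, ffAbar_sub_ffAbarS_mem_V0sub a0 abar,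
    ffAbar_mem_V0sub a0 abar, isSemisimple_ffAbarS_restrict a0 abar hω₀ ha0,
    isNilpotent_ffAbar_sub_ffAbarS_restrict a0 abar, commute_ffAbarS_restrict a0 abar hcomm,
    LinearMap.ext fun x => Subtype.ext (by simp)⟩
end
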